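/- arXiv:1010.1549 — 2 statements merged into one kernel-verified Lean document; each statement's English description precedes it below -/
import Mathlib

section
/- Let f : [0,∞) → [0,∞) be a sigmoidal function with inflection point t_inf, and let w satisfy 0 < w ≤ f'(t_inf). Let t† = max{t ≥ 0 : f'(t) = w} (which exists). Then for every t ≥ 0, f(t) − w·t ≤ max{ f(0), f(t†) − w·t† }; that is, the maximum of t ↦ f(t) − w·t over [0,∞) is attained either at 0 or at t†. -/
/-- **Static queue with latency penalty (Theorem 2, single stage).**
Let `f : [0,∞) → [0,∞)` be a sigmoidal function with inflection point `tinf`, and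
let `0 < w ≤ f' tinf`.  Then `t† = max {t ≥ 0 : f' t = w}` exists, and for every
`t ≥ 0` one has `f t - w * t ≤ max (f 0) (f t† - w * t†)`: the maximum of
`t ↦ f t - w * t` over `[0,∞)` is attained either at `0` or at `t†`. -/
theorem static_queue_latency_penalty_stage
    (f f' f'' : ℝ → ℝ) (tinf : ℝ) (htinf : 0 < tinf)
    (hrange : ∀ t ∈ Set.Ici (0 : ℝ), 0 ≤ f t)
    (hder1 : ∀ t ∈ Set.Ici (0 : ℝ), HasDerivWithinAt f (f' t) (Set.Ici 0) t)
    (hder2 : ∀ t ∈ Set.Ici (0 : ℝ), HasDerivWithinAt f' (f'' t) (Set.Ici 0) t)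
    (hcont2 : ContinuousOn f'' (Set.Ici 0))
    (hmono : MonotoneOn f (Set.Ici 0))
    (hconvex : ConvexOn ℝ (Set.Icc 0 tinf) f)
    (hconcave : ConcaveOn ℝ (Set.Ici tinf) f)
    (hder0 : 0 ≤ f' 0)
    (hlim : Filter.Tendsto f' Filter.atTop (nhds 0))
    (w : ℝ) (hw0 : 0 < w) (hw : w ≤ f' tinf) :
    ∃ tdag : ℝ, IsGreatest {t : ℝ | 0 ≤ t ∧ f' t = w} tdag ∧
      ∀ t : ℝ, 0 ≤ t → f t - w * t ≤ max (f 0) (f tdag - w * tdag) := by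
  have hcont : ContinuousOn f' (Set.Ici 0) := fun t ht => (hder2 t ht).continuousWithinAt
  obtain ⟨M, hM⟩ := Filter.eventually_atTop.1 (hlim.eventually_lt_const hw0)
  have hle : tinf ≤ max M tinf := le_max_right _ _
  obtain ⟨s, ⟨hs, -⟩, hsw⟩ := intermediate_value_Icc' hle
    (hcont.mono fun x hx => htinf.le.trans hx.1) ⟨(hM _ (le_max_left _ _)).le, hw⟩
  have hs0 : s ∈ {t : ℝ | 0 ≤ t ∧ f' t = w} := ⟨htinf.le.trans hs, hsw⟩
  have hbdd : BddAbove {t : ℝ | 0 ≤ t ∧ f' t = w} :=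
    ⟨M, fun t ht => le_of_not_ge fun h => (hM t h).ne ht.2⟩
  have hclosed : IsClosed {t : ℝ | 0 ≤ t ∧ f' t = w} :=
    hcont.preimage_isClosed_of_isClosed isClosed_Ici isClosed_singleton
  obtain ⟨a, ha⟩ : ∃ a, IsGreatest {t : ℝ | 0 ≤ t ∧ f' t = w} a :=
    ⟨_, hclosed.isGreatest_csSup ⟨s, hs0⟩ hbdd⟩
  have hta : tinf ≤ a := hs.trans (ha.2 hs0)
  have hda : HasDerivWithinAt f w (Set.Ici tinf) a :=
    ha.1.2 ▸ (hder1 a ha.1.1).mono (Set.Ici_subset_Ici.2 htinf.le)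
  have htangent : ∀ t, tinf ≤ t → f t - w * t ≤ f a - w * a := by
    intro t ht
    rcases lt_trichotomy t a with h | rfl | h
    · have := hconcave.le_slope_of_hasDerivWithinAt ht hta h hda
      rw [slope_def_field, le_div_iff₀ (sub_pos.2 h)] at this
      linarith
    · exact le_rfl
    · have := hconcave.slope_le_of_hasDerivWithinAt hta ht h hda
      rw [slope_def_field, div_le_iff₀ (sub_pos.2 h)] at this
      linarith
  refine ⟨a, ha, fun t ht => ?_⟩
  rcases le_total tinf t with h | h
  · exact (htangent t h).trans (le_max_right _ _)
  · have hlin : ConcaveOn ℝ (Set.Icc 0 tinf) fun x : ℝ => w * x :=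
      (LinearMap.mul ℝ ℝ w).concaveOn (convex_Icc _ _)
    have := (hconvex.sub hlin).le_max_of_mem_Icc (Set.left_mem_Icc.2 htinf.le)
      (Set.right_mem_Icc.2 htinf.le) ⟨ht, h⟩
    simp only [Pi.sub_apply, mul_zero, sub_zero] at this
    exact this.trans (max_le_max_left _ (htangent tinf le_rfl))
end

section
/- Let f : [0,∞) → ℝ, let N ≥ 1, c > 0, λ > 0, n₁ ∈ ℕ, and let J be the finite-horizon reward. For t ∈ [0,∞)^N, indices j, k ∈ {1,…,N}, and t̄ the vector obtained from t by swapping coordinates j and k (t̄_j = t_k, t̄_k = t_j, t̄_i = t_i otherwise), one has J(t) − J(t̄) = (c/N)·(j − k)·(t_j − t_k). -/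
open Finset in
/-- The finite-horizon reward of the dynamic decision making queue:
`J t = (1/N) ( ∑_{ℓ=1}^N ( f (t ℓ) - c (n₁ - ℓ + 1) t ℓ ) - (c λ / 2) (∑ t ℓ)² )`,
where the index `ℓ : Fin N` represents task `ℓ + 1`. -/
noncomputable def finiteHorizonReward (f : ℝ → ℝ) (N : ℕ) (c lam : ℝ) (n₁ : ℕ)
    (t : Fin N → ℝ) : ℝ :=
  (1 / (N : ℝ)) *
    ((∑ ℓ : Fin N, (f (t ℓ) - c * ((n₁ : ℝ) - (((ℓ : ℕ) : ℝ) + 1) + 1) * t ℓ)) -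
      (c * lam / 2) * (∑ ℓ : Fin N, t ℓ) ^ 2)

/-- Swapping two entries of one factor in a weighted sum changes it by the product of the
differences of the two weights and the two entries. -/
theorem sum_mul_sub_sum_mul_comp_swap {ι R : Type*} [Fintype ι] [DecidableEq ι] [CommRing R]
    (a t : ι → R) (j k : ι) :
    ∑ i, a i * t i - ∑ i, a i * t (Equiv.swap j k i) = (a j - a k) * (t j - t k) := by
  rw [← Finset.sum_sub_distrib]
  rcases eq_or_ne j k with rfl | hjk
  · simp
  · rw [Fintype.sum_eq_add j k hjk]
    · simp only [Equiv.swap_apply_left, Equiv.swap_apply_right]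
      ring
    · rintro i ⟨hij, hik⟩
      rw [Equiv.swap_apply_of_ne_of_ne hij hik, sub_self]

/-- **Swap formula for the finite-horizon reward.**
For `t ∈ [0,∞)^N`, indices `j, k`, and `t̄` obtained from `t` by swapping
coordinates `j` and `k`, one has
`J t - J t̄ = (c / N) * (j - k) * (t j - t k)`. -/
theorem reward_swap_difference
    (f : ℝ → ℝ) (N : ℕ) (hN : 1 ≤ N) (c lam : ℝ) (hc : 0 < c) (hlam : 0 < lam)
    (n₁ : ℕ) (t : Fin N → ℝ) (ht : ∀ i, 0 ≤ t i) (j k : Fin N) :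
    finiteHorizonReward f N c lam n₁ t -
        finiteHorizonReward f N c lam n₁ (t ∘ Equiv.swap j k) =
      (c / (N : ℝ)) * (((j : ℕ) : ℝ) - ((k : ℕ) : ℝ)) * (t j - t k) := by
  have hf : ∑ i, f (t (Equiv.swap j k i)) = ∑ i, f (t i) :=
    Equiv.sum_comp (Equiv.swap j k) fun i => f (t i)
  have h_sum : ∑ i, t (Equiv.swap j k i) = ∑ i, t i := Equiv.sum_comp (Equiv.swap j k) t
  have hw := sum_mul_sub_sum_mul_comp_swap
    (fun i : Fin N => c * ((n₁ : ℝ) - (((i : ℕ) : ℝ) + 1) + 1)) t j k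
  simp only [finiteHorizonReward, Function.comp_apply, Finset.sum_sub_distrib, hf, h_sum]
  linear_combination (-(1 / (N : ℝ))) * hw
end
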